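/- Same-cell correlation bound (Appendix C, case 1): Let T ≥ 2 be an integer. For all q, q̄ ∈ Q4^{T−1} with q ≠ q̄, one has |c^{−1} + Σ_{j=1}^{T−1} conj(q_j)·q̄_j|² ≤ (c^{−1} + T − 2)² + 1, and equality holds whenever q and q̄ agree in all coordinates except one coordinate j₀ at which conj(q_{j₀})·q̄_{j₀} = ±i. -/

import Mathlib

open MeasureTheory
open scoped BigOperators

/-- The standard normal cumulative distribution function. -/
noncomputable def stdNormalCDF (x : ℝ) : ℝ :=
  ∫ t in Set.Iic x, (Real.sqrt (2 * Real.pi))⁻¹ * Real.exp (-t ^ 2 / 2)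

/-- The unit-modulus 4-QAM alphabet. -/
def Q4 : Set ℂ :=
  {(1 + Complex.I) / (Real.sqrt 2 : ℂ), (1 - Complex.I) / (Real.sqrt 2 : ℂ),
   (-1 + Complex.I) / (Real.sqrt 2 : ℂ), (-1 - Complex.I) / (Real.sqrt 2 : ℂ)}

/-- The standard normal distribution function takes the value `1 / 2` at `0`. -/
theorem stdNormalCDF_zero : stdNormalCDF 0 = 1 / 2 := by
  have h := integral_gaussian_Ioi (1 / 2)
  have h2 := integral_comp_neg_Iic (0 : ℝ) (fun x => Real.exp (-(1 / 2) * x ^ 2))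
  rw [neg_zero, h] at h2
  have h3 : Real.sqrt (Real.pi / (1 / 2)) = Real.sqrt (2 * Real.pi) := by
    congr 1; ring
  have hpos : 0 < Real.sqrt (2 * Real.pi) := Real.sqrt_pos.2 (by positivity)
  have h4 : (∫ t in Set.Iic (0 : ℝ), Real.exp (-t ^ 2 / 2)) = Real.sqrt (2 * Real.pi) / 2 := by
    rw [← h3, ← h2]
    congr 1
    ext t
    congr 1
    ring
  rw [stdNormalCDF, integral_const_mul, h4]
  field_simp

/-- The reciprocal of `(1 - exp (-m ^ 2)) / (1 + exp (-m ^ 2))` is at least `1` for `m ≠ 0`. -/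
theorem one_le_inv_one_sub_exp_div {m : ℝ} (hm : m ≠ 0) :
    1 ≤ ((1 - Real.exp (-m ^ 2)) / (1 + Real.exp (-m ^ 2)))⁻¹ := by
  have h1 : Real.exp (-m ^ 2) < 1 := by
    rw [Real.exp_lt_one_iff]
    have := sq_pos_of_ne_zero hm
    linarith
  have h0 := Real.exp_pos (-m ^ 2)
  rw [inv_div, le_div_iff₀ (by linarith)]
  linarith

/-- Membership in `Q4` in terms of coordinates. -/
theorem exists_sign_of_mem_Q4 {z : ℂ} (hz : z ∈ Q4) :
    (z.re = (Real.sqrt 2)⁻¹ ∨ z.re = -(Real.sqrt 2)⁻¹) ∧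
      (z.im = (Real.sqrt 2)⁻¹ ∨ z.im = -(Real.sqrt 2)⁻¹) := by
  simp only [Q4, Set.mem_insert_iff, Set.mem_singleton_iff] at hz
  rcases hz with rfl | rfl | rfl | rfl <;>
    simp [Complex.div_ofReal_re, Complex.div_ofReal_im, neg_div]

/-- The correlation of two symbols of `Q4` is a fourth root of unity, equal to `1` only if the
symbols coincide. -/
theorem conj_mul_of_mem_Q4 {z w : ℂ} (hz : z ∈ Q4) (hw : w ∈ Q4) :
    (z = w ∧ (starRingEnd ℂ) z * w = 1) ∨
      (z ≠ w ∧ ((starRingEnd ℂ) z * w = -1 ∨ (starRingEnd ℂ) z * w = Complex.I ∨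
        (starRingEnd ℂ) z * w = -Complex.I)) := by
  obtain ⟨hz1, hz2⟩ := exists_sign_of_mem_Q4 hz
  obtain ⟨hw1, hw2⟩ := exists_sign_of_mem_Q4 hw
  have hs : (Real.sqrt 2)⁻¹ * (Real.sqrt 2)⁻¹ = 1 / 2 := by
    rw [← mul_inv, Real.mul_self_sqrt (by norm_num)]; norm_num
  have hpos : 0 < (Real.sqrt 2)⁻¹ := by positivity
  generalize (Real.sqrt 2)⁻¹ = s at *
  have hne : s ≠ -s := by linarith
  have hne' : -s ≠ s := by linarith
  rcases hz1 with h1 | h1 <;> rcases hz2 with h2 | h2 <;> rcases hw1 with h3 | h3 <;>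
    rcases hw2 with h4 | h4 <;>
    norm_num [Complex.ext_iff, h1, h2, h3, h4, hs, hne, hne']

/-- Correlation bound in real coordinates: `(x, y)` is the contribution of `N` coordinates and
`(u, v) ∈ {(-1, 0), (0, 1), (0, -1)}` that of a coordinate where the sequences differ. -/
theorem sq_add_sq_le_of_abs_add_abs_le {a x y N u v : ℝ} (ha : 1 ≤ a) (h : |x| + |y| ≤ N)
    (huv : (u = -1 ∧ v = 0) ∨ (u = 0 ∧ |v| = 1)) :
    (a + (u + x)) ^ 2 + (v + y) ^ 2 ≤ (a + N) ^ 2 + 1 := by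
  have hy := abs_nonneg y
  have hx := abs_le.1 (show |x| ≤ N - |y| by linarith)
  have hx0 : 0 ≤ N - |y| := (abs_nonneg x).trans (by linarith)
  have hyy := sq_abs y
  rcases huv with ⟨rfl, rfl⟩ | ⟨rfl, hv⟩
  · have h1 : (a + (-1 + x)) ^ 2 ≤ (a - 1 + (N - |y|)) ^ 2 :=
      sq_le_sq' (by linarith) (by linarith)
    nlinarith [mul_nonneg hy hx0, mul_nonneg hy (sub_nonneg.2 ha)]
  · have h1 : (a + (0 + x)) ^ 2 ≤ (a + (N - |y|)) ^ 2 :=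
      sq_le_sq' (by linarith) (by linarith)
    have h2 : (v + y) ^ 2 ≤ (1 + |y|) ^ 2 := by
      rw [← sq_abs]
      have := abs_add_le v y
      exact pow_le_pow_left₀ (abs_nonneg _) (by linarith) 2
    nlinarith [mul_nonneg hy hx0, mul_nonneg hy (sub_nonneg.2 ha)]

/-- Same-cell correlation bound (Appendix C, case 1). -/
theorem stmt_3 (T : ℕ) (hT : 2 ≤ T) (m cc : ℝ)
    (hm : stdNormalCDF m = 3 / 4)
    (hcc : cc = (1 - Real.exp (-m ^ 2)) / (1 + Real.exp (-m ^ 2)))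
    (q qb : Fin (T - 1) → ℂ) (hq : ∀ j, q j ∈ Q4) (hqb : ∀ j, qb j ∈ Q4)
    (hne : q ≠ qb) :
    ‖((cc⁻¹ : ℝ) : ℂ) + ∑ j, (starRingEnd ℂ) (q j) * qb j‖ ^ 2 ≤
      (cc⁻¹ + (T : ℝ) - 2) ^ 2 + 1 ∧
    ∀ j0 : Fin (T - 1), (∀ j, j ≠ j0 → q j = qb j) →
      ((starRingEnd ℂ) (q j0) * qb j0 = Complex.I ∨
        (starRingEnd ℂ) (q j0) * qb j0 = -Complex.I) →
      ‖((cc⁻¹ : ℝ) : ℂ) + ∑ j, (starRingEnd ℂ) (q j) * qb j‖ ^ 2 =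
        (cc⁻¹ + (T : ℝ) - 2) ^ 2 + 1 := by
  obtain ⟨N, rfl⟩ : ∃ N, T = N + 2 := ⟨T - 2, by omega⟩
  have hm0 : m ≠ 0 := by
    rintro rfl
    rw [stdNormalCDF_zero] at hm
    norm_num at hm
  have ha : 1 ≤ cc⁻¹ := hcc ▸ one_le_inv_one_sub_exp_div hm0
  generalize cc⁻¹ = a at *
  have key : ∀ z : ℂ, ‖(a : ℂ) + z‖ ^ 2 = (a + z.re) ^ 2 + z.im ^ 2 := by
    intro z
    rw [← Complex.normSq_eq_norm_sq, Complex.normSq_apply]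
    simp
    ring
  have hcorr := fun j => conj_mul_of_mem_Q4 (hq j) (hqb j)
  have hcard : ∀ j0 : Fin (N + 2 - 1), (Finset.univ.erase j0).card = N := by
    intro j0
    simp [Finset.card_erase_of_mem]
  have hT' : a + ((N + 2 : ℕ) : ℝ) - 2 = a + N := by push_cast; ring
  rw [hT']
  constructor
  · obtain ⟨j0, hj0⟩ := Function.ne_iff.1 hne
    have habs : |(∑ j ∈ Finset.univ.erase j0, (starRingEnd ℂ) (q j) * qb j).re| +
        |(∑ j ∈ Finset.univ.erase j0, (starRingEnd ℂ) (q j) * qb j).im| ≤ (N : ℝ) := by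
      rw [Complex.re_sum, Complex.im_sum]
      refine (add_le_add (Finset.abs_sum_le_sum_abs _ _)
        (Finset.abs_sum_le_sum_abs _ _)).trans ?_
      rw [← Finset.sum_add_distrib]
      refine (Finset.sum_le_card_nsmul _ _ 1 fun j _ => ?_).trans (by simp [hcard])
      rcases hcorr j with ⟨_, h⟩ | ⟨_, h | h | h⟩ <;> rw [h] <;> simp
    rw [key, ← Finset.add_sum_erase _ _ (Finset.mem_univ j0), Complex.add_re, Complex.add_im]
    refine sq_add_sq_le_of_abs_add_abs_le ha habs ?_
    rcases hcorr j0 with ⟨h, _⟩ | ⟨_, h | h | h⟩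
    · exact absurd h hj0
    all_goals rw [h]; simp
  · intro j0 hagree hI
    have hsum : ∑ j ∈ Finset.univ.erase j0, (starRingEnd ℂ) (q j) * qb j = (N : ℂ) := by
      rw [Finset.sum_congr rfl (g := fun _ => (1 : ℂ)), Finset.sum_const, hcard]
      · simp
      · intro j hj
        rcases hcorr j with ⟨_, h⟩ | ⟨h, _⟩
        · exact h
        · exact absurd (hagree j (Finset.ne_of_mem_erase hj)) h
    rw [key, ← Finset.add_sum_erase _ _ (Finset.mem_univ j0), hsum]
    rcases hI with h | h <;> rw [h] <;> simp
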